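/- arXiv:0704.2712 — 4 statements merged into one kernel-verified Lean document; each statement's English description precedes it below -/
import Mathlib

section
/- Let x₀ > 0, let T : [x₀,∞) → (0,∞) be nondecreasing, and let 0 < α < β. Then there exists a measurable set E ⊆ [x₀,∞) of finite Lebesgue measure such that for every x ∈ [x₀,∞)\E one has x − T(x)^{-β} ≥ x₀, T(x + T(x)^{-β}) < (1 + T(x)^{-α})·T(x), and T(x − T(x)^{-β}) > (1 − T(x)^{-α})·T(x). -/
open Set Metric MeasureTheory Filter

/-- A weak-type bound for the maximal function of a finite measure on the line: a set covered by
intervals of bounded length, each having `μ`-measure at least a fixed multiple of its length,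
has finite Lebesgue measure. -/
theorem volume_lt_top_of_forall_exists_Icc {μ : Measure ℝ} [IsFiniteMeasure μ] {A : Set ℝ}
    {c R : ℝ} (hc : 0 < c)
    (h : ∀ x ∈ A, ∃ a b, a < b ∧ b - a ≤ R ∧ x ∈ Icc a b ∧
      ENNReal.ofReal (c * (b - a)) ≤ μ (Icc a b)) :
    volume A < ⊤ := by
  choose! a b hab hR hmem hμ using h
  have hball (x : ℝ) : closedBall ((a x + b x) / 2) ((b x - a x) / 2) = Icc (a x) (b x) :=
    (Real.Icc_eq_closedBall _ _).symm
  obtain ⟨u, huA, hdisj, hcov⟩ := Vitali.exists_disjoint_subfamily_covering_enlargement_closedBall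
    A (fun x => (a x + b x) / 2) (fun x => (b x - a x) / 2) (R / 2)
    (fun x hx => by have := hR x hx; linarith) 5 (by norm_num)
  simp only [hball] at hdisj hcov
  have hu : u.Countable := hdisj.countable_of_nonempty_interior fun x hx => by
    rw [interior_Icc]
    exact nonempty_Ioo.2 (hab x (huA hx))
  have hsub : A ⊆ ⋃ x ∈ u, closedBall ((a x + b x) / 2) (5 * ((b x - a x) / 2)) := by
    intro x hx
    obtain ⟨y, hy, hxy⟩ := hcov x hx
    exact mem_biUnion hy (hxy (hmem x hx))
  have hvol (x : u) : volume (closedBall ((a x + b x) / 2) (5 * ((b x - a x) / 2)))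
      ≤ ENNReal.ofReal (5 / c) * μ (Icc (a x) (b x)) := by
    rw [Real.volume_closedBall]
    calc ENNReal.ofReal (2 * (5 * ((b x - a x) / 2)))
        = ENNReal.ofReal (5 / c) * ENNReal.ofReal (c * (b x - a x)) := by
          rw [← ENNReal.ofReal_mul (by positivity)]
          congr 1
          field_simp
      _ ≤ _ := by gcongr; exact hμ x (huA x.2)
  calc volume A
      ≤ ∑' x : u, volume (closedBall ((a x + b x) / 2) (5 * ((b x - a x) / 2))) :=
        (measure_mono hsub).trans (measure_biUnion_le _ hu _)
    _ ≤ ∑' x : u, ENNReal.ofReal (5 / c) * μ (Icc (a x) (b x)) := ENNReal.tsum_le_tsum hvol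
    _ = ENNReal.ofReal (5 / c) * μ (⋃ x ∈ u, Icc (a x) (b x)) := by
        rw [ENNReal.tsum_mul_left, measure_biUnion hu hdisj fun _ _ => measurableSet_Icc]
    _ < ⊤ := ENNReal.mul_lt_top ENNReal.ofReal_lt_top (measure_lt_top _ _)

/-- The Stieltjes measure of a closed interval dominates the increment of the function. -/
theorem Monotone.ofReal_sub_le_stieltjesFunction_measure_Icc {f : ℝ → ℝ} (hf : Monotone f)
    (a b : ℝ) : ENNReal.ofReal (f b - f a) ≤ hf.stieltjesFunction.measure (Icc a b) := by
  rw [StieltjesFunction.measure_Icc]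
  gcongr
  · rw [hf.stieltjesFunction_eq]
    exact hf.le_rightLim le_rfl
  · refine _root_.le_of_tendsto (hf.stieltjesFunction.mono.tendsto_leftLim a) ?_
    filter_upwards [self_mem_nhdsWithin] with y hy
    rw [hf.stieltjesFunction_eq]
    exact hf.rightLim_le hy

/-- A bounded monotone function can increase at a rate at least `c > 0` over intervals of bounded
length only around the points of a set of finite measure. -/
theorem Monotone.volume_lt_top_of_forall_exists_Icc {f : ℝ → ℝ} (hf : Monotone f) {C : ℝ}
    (hC : ∀ x, |f x| ≤ C) {A : Set ℝ} {c R : ℝ} (hc : 0 < c)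
    (h : ∀ x ∈ A, ∃ a b, a < b ∧ b - a ≤ R ∧ x ∈ Icc a b ∧ c * (b - a) ≤ f b - f a) :
    volume A < ⊤ := by
  have : IsFiniteMeasure hf.stieltjesFunction.measure := by
    refine StieltjesFunction.isFiniteMeasure_of_forall_abs_le _ (C := C) fun x => ?_
    rw [hf.stieltjesFunction_eq, abs_le]
    exact ⟨(abs_le.1 (hC x)).1.trans (hf.le_rightLim le_rfl),
      (hf.rightLim_le (lt_add_one x)).trans (abs_le.1 (hC _)).2⟩
  refine _root_.volume_lt_top_of_forall_exists_Icc (μ := hf.stieltjesFunction.measure) hc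
    (R := R) fun x hx => ?_
  obtain ⟨a, b, hab, hR, hmem, hle⟩ := h x hx
  exact ⟨a, b, hab, hR, hmem, (ENNReal.ofReal_le_ofReal hle).trans
    (hf.ofReal_sub_le_stieltjesFunction_measure_Icc a b)⟩

/-- A linear upper bound for `(1 + s) ^ (-γ)` on a bounded interval `[0, s₀]`. -/
theorem Real.exists_one_add_rpow_neg_le_one_sub_mul {γ s₀ : ℝ} (hγ : 0 < γ) (hs₀ : 0 ≤ s₀) :
    ∃ c > 0, ∀ s, 0 ≤ s → s ≤ s₀ → (1 + s) ^ (-γ) ≤ 1 - c * s := by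
  set k := γ / (1 + s₀) with hk
  have hk0 : 0 < k := by positivity
  refine ⟨k / (1 + k * s₀), by positivity, fun s hs hss => ?_⟩
  have h1 : 1 + k * s ≤ (1 + s) ^ γ := by
    have hlog := Real.one_sub_inv_le_log_of_pos (x := 1 + s) (by positivity)
    have hexp := Real.add_one_le_exp (Real.log (1 + s) * γ)
    rw [Real.rpow_def_of_pos (by positivity)]
    have : k * s ≤ (1 - (1 + s)⁻¹) * γ := by
      have : (1 - (1 + s)⁻¹) * γ = γ / (1 + s) * s := by field_simp; ring
      rw [this, hk]
      gcongr
    nlinarith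
  have h2 : k / (1 + k * s₀) * (1 + k * s) ≤ k := by
    rw [div_mul_eq_mul_div, div_le_iff₀ (by positivity)]
    gcongr
  rw [Real.rpow_neg (by positivity)]
  refine (inv_anti₀ (by positivity) h1).trans ?_
  rw [inv_le_iff_one_le_mul₀ (by positivity)]
  nlinarith [mul_le_mul_of_nonneg_right h2 hs]

/-- Borel–Nevanlinna growth lemma for real functions. -/
theorem stmt15 (x₀ : ℝ) (hx₀ : 0 < x₀) (T : ℝ → ℝ)
    (hpos : ∀ x ≥ x₀, 0 < T x)
    (hmono : ∀ x y, x₀ ≤ x → x ≤ y → T x ≤ T y)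
    (α β : ℝ) (hα : 0 < α) (hαβ : α < β) :
    ∃ E : Set ℝ, E ⊆ Set.Ici x₀ ∧ MeasurableSet E ∧ MeasureTheory.volume E < ⊤ ∧
      ∀ x ∈ Set.Ici x₀ \ E,
        x₀ ≤ x - T x ^ (-β) ∧
        T (x + T x ^ (-β)) < (1 + T x ^ (-α)) * T x ∧
        (1 - T x ^ (-α)) * T x < T (x - T x ^ (-β)) := by
  have hanti (p : ℝ) (hp : 0 < p) (x y : ℝ) (hx : x₀ ≤ x) (hxy : x ≤ y) :
      T y ^ (-p) ≤ T x ^ (-p) :=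
    Real.rpow_le_rpow_of_nonpos (hpos x hx) (hmono x y hx hxy) (by linarith)
  have hβ : 0 < β := hα.trans hαβ
  have hγ : 0 < β - α := sub_pos.2 hαβ
  obtain ⟨c, hc, hbound⟩ := Real.exists_one_add_rpow_neg_le_one_sub_mul hγ
    (Real.rpow_nonneg (hpos x₀ le_rfl).le (-α))
  set f : ℝ → ℝ := fun x => -T (max x x₀) ^ (-(β - α)) with hf_def
  have hf : Monotone f := fun x y hxy =>
    neg_le_neg (hanti _ hγ _ _ (le_max_right _ _) (max_le_max_right _ hxy))
  have hfC (x : ℝ) : |f x| ≤ T x₀ ^ (-(β - α)) := by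
    rw [hf_def, abs_neg, abs_of_nonneg (Real.rpow_nonneg (hpos _ (le_max_right _ _)).le _)]
    exact hanti _ hγ _ _ le_rfl (le_max_right _ _)
  have hincr (x y z : ℝ) (hy : x₀ ≤ y) (hyx : y ≤ x) (hxz : x ≤ z)
      (hT : (1 + T x ^ (-α)) * T y ≤ T z) : c * T x ^ (-β) ≤ f z - f y := by
    have hx := hy.trans hyx
    have hTx := hpos x hx
    have hTy := hpos y hy
    have hs : 0 ≤ T x ^ (-α) := Real.rpow_nonneg hTx.le _
    have h1 : T z ^ (-(β - α)) ≤ (1 - c * T x ^ (-α)) * T y ^ (-(β - α)) := by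
      refine (Real.rpow_le_rpow_of_nonpos (by positivity) hT (by linarith)).trans ?_
      rw [Real.mul_rpow (by positivity) hTy.le]
      gcongr
      exact hbound _ hs (hanti α hα _ _ le_rfl hx)
    have h2 : T x ^ (-β) = T x ^ (-α) * T x ^ (-(β - α)) := by
      rw [← Real.rpow_add hTx]
      congr 1
      ring
    have h3 : c * (T x ^ (-α) * T x ^ (-(β - α))) ≤ c * (T x ^ (-α) * T y ^ (-(β - α))) :=
      mul_le_mul_of_nonneg_left (mul_le_mul_of_nonneg_left (hanti _ hγ _ _ hy hyx) hs) hc.le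
    simp only [hf_def, max_eq_left hy, max_eq_left (hx.trans hxz), h2]
    linarith
  set A : Set ℝ := {x | x₀ + T x₀ ^ (-β) ≤ x ∧ ¬ (T (x + T x ^ (-β)) < (1 + T x ^ (-α)) * T x ∧
    (1 - T x ^ (-α)) * T x < T (x - T x ^ (-β)))}
  have hle (x : ℝ) (hx : x₀ + T x₀ ^ (-β) ≤ x) :
      x₀ ≤ x ∧ T x ^ (-β) ≤ T x₀ ^ (-β) ∧ x₀ ≤ x - T x ^ (-β) := by
    have h0 : x₀ ≤ x := by
      have := Real.rpow_nonneg (hpos x₀ le_rfl).le (-β)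
      linarith
    have h1 := hanti β hβ _ _ le_rfl h0
    exact ⟨h0, h1, by linarith⟩
  have hA : volume A < ⊤ := by
    refine hf.volume_lt_top_of_forall_exists_Icc hfC hc (R := T x₀ ^ (-β)) ?_
    rintro x ⟨hx, hbad⟩
    obtain ⟨h0, hR, hl⟩ := hle x hx
    have hTx := hpos x h0
    have hδ : 0 < T x ^ (-β) := Real.rpow_pos_of_pos hTx _
    by_cases hright : T (x + T x ^ (-β)) < (1 + T x ^ (-α)) * T x
    · have hleft : T (x - T x ^ (-β)) ≤ (1 - T x ^ (-α)) * T x :=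
        not_lt.1 fun h => hbad ⟨hright, h⟩
      refine ⟨x - T x ^ (-β), x, by linarith, by linarith, ⟨by linarith, le_rfl⟩, ?_⟩
      rw [sub_sub_cancel]
      refine hincr x _ _ hl (by linarith) le_rfl ?_
      have hs : 0 < T x ^ (-α) := Real.rpow_pos_of_pos hTx _
      calc (1 + T x ^ (-α)) * T (x - T x ^ (-β))
          ≤ (1 + T x ^ (-α)) * ((1 - T x ^ (-α)) * T x) := by gcongr
        _ = T x - (T x ^ (-α)) ^ 2 * T x := by ring
        _ ≤ T x := sub_le_self _ (by positivity)
    · refine ⟨x, x + T x ^ (-β), by linarith, by linarith, ⟨le_rfl, by linarith⟩, ?_⟩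
      rw [add_sub_cancel_left]
      exact hincr x _ _ h0 le_rfl (by linarith) (not_lt.1 hright)
  refine ⟨(Icc x₀ (x₀ + T x₀ ^ (-β)) ∪ toMeasurable volume A) ∩ Ici x₀, inter_subset_right,
    (measurableSet_Icc.union (measurableSet_toMeasurable _ _)).inter measurableSet_Ici,
    (measure_mono inter_subset_left).trans_lt (measure_union_lt_top ?_ ?_), ?_⟩
  · exact measure_Icc_lt_top
  · rwa [measure_toMeasurable]
  · rintro x ⟨hx, hxE⟩
    have hx1 : x₀ + T x₀ ^ (-β) ≤ x := by
      by_contra! hlt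
      exact hxE ⟨Or.inl ⟨hx, hlt.le⟩, hx⟩
    refine ⟨(hle x hx1).2.2, ?_⟩
    by_contra hbad
    exact hxE ⟨Or.inr (subset_toMeasurable _ _ ⟨hx1, hbad⟩), hx⟩
end

section
/- Let x₀ > 0, let Φ : [x₀,∞) → (0,∞) be increasing and convex, and let β > 1/2. Denote by Φ'(x) the right derivative of Φ at x (which exists at every point by convexity). Then there exists a measurable set E ⊆ [x₀,∞) of finite Lebesgue measure such that for every ε > 0 there is X ≥ x₀ with the property: for every x ≥ X with x ∉ E and Φ'(x) > 0, and every real h with |h| ≤ Φ'(x)^{-β} and x + h ≥ x₀, one has Φ(x + h) ≤ Φ(x) + Φ'(x)·h + ε. -/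
open Set Metric MeasureTheory Filter

/-- Borel's growth lemma: a monotone function `u` can jump by `1` within distance `u(x)^(-b)`
of `x` only for `x` in a set of finite measure, provided `1 < b`. -/
theorem volume_setOf_growth_lt_top {u : ℝ → ℝ} (hu : Monotone u) {b : ℝ} (hb : 1 < b) :
    volume {x | 1 ≤ u x ∧
      (u x + 1 ≤ u (x + u x ^ (-b)) ∨ u (x - u x ^ (-b)) ≤ u x - 1)} < ⊤ := by
  have slice : ∀ P : ℝ → Prop,
      (∀ x y, x < y → 1 ≤ u x → P x → P y → u y < u x + 1 →
        y - x ≤ u x ^ (-b)) →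
      volume {x | 1 ≤ u x ∧ P x} < ⊤ := by
    intro P hP
    have hsub : {x | 1 ≤ u x ∧ P x} ⊆
        ⋃ n : ℕ, {x | (1 ≤ u x ∧ P x) ∧ ⌊u x⌋₊ = n} :=
      fun x hx => mem_iUnion.2 ⟨_, hx, rfl⟩
    refine (measure_mono hsub).trans_lt ((measure_iUnion_le _).trans_lt ?_)
    have hle : ∀ n : ℕ, volume {x | (1 ≤ u x ∧ P x) ∧ ⌊u x⌋₊ = n} ≤
        ENNReal.ofReal ((n : ℝ) ^ (-b)) := by
      intro n
      refine (Real.volume_le_diam _).trans (ediam_le_of_forall_dist_le ?_)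
      have key : ∀ x y, x < y → ((1 ≤ u x ∧ P x) ∧ ⌊u x⌋₊ = n) →
          ((1 ≤ u y ∧ P y) ∧ ⌊u y⌋₊ = n) → y - x ≤ (n : ℝ) ^ (-b) := by
        rintro x y hxy ⟨⟨hx, hPx⟩, hnx⟩ ⟨⟨hy, hPy⟩, hny⟩
        have h1 : (n : ℝ) ≤ u x := hnx ▸ Nat.floor_le (by linarith)
        have h2 : u y < n + 1 := hny ▸ Nat.lt_floor_add_one (u y)
        have hn : (0 : ℝ) < n := by
          have : 1 ≤ n := hnx ▸ Nat.le_floor (by simpa using hx)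
          exact_mod_cast this
        exact (hP x y hxy hx hPx hPy (by linarith)).trans
          (Real.rpow_le_rpow_of_nonpos hn h1 (by linarith))
      intro x hx y hy
      rcases lt_trichotomy x y with h | rfl | h
      · rw [dist_comm, Real.dist_eq, abs_of_pos (by linarith)]
        exact key x y h hx hy
      · rw [dist_self]; positivity
      · rw [Real.dist_eq, abs_of_pos (by linarith)]
        exact key y x h hy hx
    refine (ENNReal.tsum_le_tsum hle).trans_lt ?_
    exact (Real.summable_nat_rpow.2 (by linarith)).tsum_ofReal_lt_top
  have hsplit : {x | 1 ≤ u x ∧ (u x + 1 ≤ u (x + u x ^ (-b)) ∨ u (x - u x ^ (-b)) ≤ u x - 1)} =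
      {x | 1 ≤ u x ∧ u x + 1 ≤ u (x + u x ^ (-b))} ∪
        {x | 1 ≤ u x ∧ u (x - u x ^ (-b)) ≤ u x - 1} := by
    ext x
    exact and_or_left
  rw [hsplit]
  refine measure_union_lt_top (slice _ ?_) (slice _ ?_)
  · intro x y hxy _ hx _ hlt
    by_contra! h
    linarith [hu (show x + u x ^ (-b) ≤ y by linarith)]
  · intro x y hxy hx1 _ hy hlt
    by_contra! h
    have := Real.rpow_le_rpow_of_nonpos (by linarith) (hu hxy.le) (show -b ≤ 0 by linarith)
    linarith [hu (show x ≤ y - u y ^ (-b) by linarith)]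

/-- A positive monotone function varies slowly at scale `F(x)^(-β)`, `β > 1/2`, outside a set
of finite measure. -/
theorem exists_volume_lt_top_eventually_mul_sub_le {F : ℝ → ℝ} (hF : Monotone F)
    (hpos : ∀ x, 0 < F x) {β : ℝ} (hβ : 1 / 2 < β) :
    ∃ E : Set ℝ, volume E < ⊤ ∧ ∀ ε > (0 : ℝ), ∀ᶠ x in atTop, x ∉ E →
      ∀ h : ℝ, |h| ≤ F x ^ (-β) → (F (x + h) - F x) * h ≤ ε := by
  rcases tendsto_atTop_of_monotone hF with hlim | ⟨l, hl⟩
  · have hu : Monotone fun x => √(F x) := fun x y hxy => Real.sqrt_le_sqrt (hF hxy)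
    refine ⟨_, volume_setOf_growth_lt_top hu (b := 2 * β) (by linarith), fun ε hε => ?_⟩
    have hdecay : Tendsto (fun x => 3 * √(F x) ^ (-(2 * β - 1))) atTop (nhds 0) := by
      simpa using (((tendsto_rpow_neg_atTop (show 0 < 2 * β - 1 by linarith)).comp
        (Real.tendsto_sqrt_atTop.comp hlim)).const_mul 3)
    filter_upwards [hdecay.eventually_le_const hε, hlim.eventually_ge_atTop 1] with x hx hF1 hxE h hh
    have hs1 : 1 ≤ √(F x) := Real.one_le_sqrt.2 hF1
    have hsq : ∀ y, √(F y) ^ 2 = F y := fun y => Real.sq_sqrt (hpos y).le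
    have hr : √(F x) ^ (-(2 * β)) = F x ^ (-β) := by
      rw [Real.sqrt_eq_rpow, ← Real.rpow_mul (hpos x).le]
      ring_nf
    simp only [not_and, not_or, not_le, hr] at hxE
    obtain ⟨hup, hdown⟩ := hxE hs1
    have hmul : √(F x) ^ (-(2 * β - 1)) = F x ^ (-β) * √(F x) := by
      rw [← hr, ← Real.rpow_add_one (by linarith)]
      ring_nf
    rw [hmul] at hx
    obtain ⟨hl, hr'⟩ := abs_le.1 hh
    have h1 := hu (show x + h ≤ x + F x ^ (-β) by linarith)
    have h2 := hu (show x - F x ^ (-β) ≤ x + h by linarith)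
    simp only at h1 h2
    have hdiff : |F (x + h) - F x| ≤ 3 * √(F x) := by
      have hlt := h1.trans_lt hup
      have hgt := hdown.trans_le h2
      have hnonneg := Real.sqrt_nonneg (F (x + h))
      have e1 := hsq x
      have e2 := hsq (x + h)
      exact abs_le.2 ⟨by nlinarith, by nlinarith⟩
    calc (F (x + h) - F x) * h ≤ |F (x + h) - F x| * |h| := by
          rw [← abs_mul]; exact le_abs_self _
      _ ≤ 3 * √(F x) * F x ^ (-β) := by gcongr
      _ ≤ ε := by linarith
  · refine ⟨∅, by simp, fun ε hε => ?_⟩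
    set R := F 0 ^ (-β)
    have hR : 0 < R := Real.rpow_pos_of_pos (hpos 0) _
    have hlim : Tendsto (fun x => (F (x + R) - F (x + -R)) * R) atTop (nhds 0) := by
      simpa using ((hl.comp (tendsto_atTop_add_const_right _ R tendsto_id)).sub
        (hl.comp (tendsto_atTop_add_const_right _ (-R) tendsto_id))).mul_const R
    filter_upwards [hlim.eventually_le_const hε, eventually_ge_atTop 0] with x hx hx0 _ h hh
    have hhR : |h| ≤ R :=
      hh.trans (Real.rpow_le_rpow_of_nonpos (hpos 0) (hF hx0) (by linarith))
    obtain ⟨h1, h2⟩ := abs_le.1 hhR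
    have hdiff : |F (x + h) - F x| ≤ F (x + R) - F (x + -R) := by
      have a1 := hF (show x + h ≤ x + R by linarith)
      have a2 := hF (show x + -R ≤ x + h by linarith)
      have a3 := hF (show x ≤ x + R by linarith)
      have a4 := hF (show x + -R ≤ x by linarith)
      exact abs_le.2 ⟨by linarith, by linarith⟩
    calc (F (x + h) - F x) * h ≤ |F (x + h) - F x| * |h| := by
          rw [← abs_mul]; exact le_abs_self _
      _ ≤ (F (x + R) - F (x + -R)) * R :=
          mul_le_mul hdiff hhR (abs_nonneg h) ((abs_nonneg _).trans hdiff)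
      _ ≤ ε := hx

/-- The graph of a convex function lies above its right tangent lines. -/
theorem ConvexOn.add_rightDeriv_mul_sub_le {S : Set ℝ} {f : ℝ → ℝ} (hf : ConvexOn ℝ S f)
    {x y : ℝ} (hx : x ∈ interior S) (hy : y ∈ S) :
    f x + derivWithin f (Ioi x) x * (y - x) ≤ f y := by
  rcases lt_trichotomy x y with h | rfl | h
  · have := hf.rightDeriv_le_slope_of_mem_interior hx hy h
    rw [slope_def_field, le_div_iff₀ (by linarith)] at this
    linarith
  · simp
  · have := (hf.slope_le_leftDeriv_of_mem_interior hy hx h).trans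
      (hf.leftDeriv_le_rightDeriv_of_mem_interior hx)
    rw [slope_def_field, div_le_iff₀ (by linarith)] at this
    linarith

/-- Growth lemma for convex functions: `Φ(x+h) ≤ Φ(x) + Φ'(x)h + o(1)` for
`|h| ≤ Φ'(x)^{-β}`, for `x` outside a set of finite measure. -/
theorem stmt16 (x₀ : ℝ) (hx₀ : 0 < x₀) (Φ : ℝ → ℝ)
    (hpos : ∀ x ≥ x₀, 0 < Φ x)
    (hmono : StrictMonoOn Φ (Set.Ici x₀))
    (hconv : ConvexOn ℝ (Set.Ici x₀) Φ)
    (β : ℝ) (hβ : 1 / 2 < β) :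
    ∃ E : Set ℝ, E ⊆ Set.Ici x₀ ∧ MeasurableSet E ∧ MeasureTheory.volume E < ⊤ ∧
      ∀ ε > (0:ℝ), ∃ X ≥ x₀, ∀ x ≥ X, x ∉ E →
        0 < derivWithin Φ (Set.Ici x) x →
        ∀ h : ℝ, |h| ≤ (derivWithin Φ (Set.Ici x) x) ^ (-β) → x₀ ≤ x + h →
          Φ (x + h) ≤ Φ x + derivWithin Φ (Set.Ici x) x * h + ε := by
  have hint : ∀ {x}, x₀ + 1 ≤ x → x ∈ interior (Ici x₀) := fun {x} hx => by
    rw [interior_Ici]; exact (lt_add_one x₀).trans_le hx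
  set D : ℝ → ℝ := fun x => derivWithin Φ (Ioi x) x
  have hDIci : ∀ x, derivWithin Φ (Ici x) x = D x := fun x => (derivWithin_Ioi_eq_Ici Φ x).symm
  have htan : ∀ x y, x₀ + 1 ≤ x → x₀ ≤ y → Φ x + D x * (y - x) ≤ Φ y :=
    fun x y hx hy => hconv.add_rightDeriv_mul_sub_le (hint hx) hy
  have hDpos : ∀ x, x₀ + 1 ≤ x → 0 < D x := by
    intro x hx
    have h1 := htan x x₀ hx le_rfl
    have h2 : Φ x₀ < Φ x := hmono self_mem_Ici (mem_Ici.2 (by linarith)) (by linarith)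
    by_contra! h
    nlinarith
  set F : ℝ → ℝ := fun x => D (max x (x₀ + 1)) with hFdef
  have hFmono : Monotone F := fun x y hxy =>
    hconv.monotoneOn_rightDeriv (hint (le_max_right _ _)) (hint (le_max_right _ _))
      (max_le_max_right _ hxy)
  have hFpos : ∀ x, 0 < F x := fun x => hDpos _ (le_max_right _ _)
  have hFD : ∀ x, x₀ + 1 ≤ x → F x = D x := fun x hx => by simp only [hFdef, max_eq_left hx]
  obtain ⟨E, hE, hEF⟩ := exists_volume_lt_top_eventually_mul_sub_le hFmono hFpos hβ
  refine ⟨toMeasurable volume E ∩ Ici x₀, inter_subset_right,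
    (measurableSet_toMeasurable _ _).inter measurableSet_Ici,
    (measure_mono inter_subset_left).trans_lt (by rwa [measure_toMeasurable]), fun ε hε => ?_⟩
  obtain ⟨X, hX⟩ := eventually_atTop.1 (hEF ε hε)
  set R := F x₀ ^ (-β)
  have hR : 0 < R := Real.rpow_pos_of_pos (hFpos x₀) _
  refine ⟨max X (x₀ + 1 + R), le_max_of_le_right (by linarith), fun x hx hxE _ h hh hxh => ?_⟩
  obtain ⟨hxX, hxR⟩ := max_le_iff.1 hx
  rw [hDIci, ← hFD x (by linarith)] at *
  have hxE' : x ∉ E := fun hmem =>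
    hxE ⟨subset_toMeasurable _ _ hmem, mem_Ici.2 (by linarith)⟩
  have hhR : |h| ≤ R :=
    hh.trans (Real.rpow_le_rpow_of_nonpos (hFpos _) (hFmono (by linarith)) (by linarith))
  have hge : x₀ + 1 ≤ x + h := by linarith [(abs_le.1 hhR).1]
  have h1 := hX x hxX hxE' h hh
  have h2 := htan (x + h) x hge (by linarith)
  rw [← hFD _ hge] at h2
  linarith
end

section
/- Let x₀ > 0 and ε > 0, let h : [x₀,∞) → (0,∞) be nondecreasing, and let H : [x₀,∞) → (0,∞) satisfy H(x) = ∫_{x₀}^{x} h(s) ds + H(x₀) for all x ≥ x₀. Then there exists a measurable set E ⊆ [x₀,∞) of finite Lebesgue measure such that h(x) ≤ H(x)^{1+ε} for all x ∈ [x₀,∞)\E. -/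
open Set Metric MeasureTheory Filter

/-- The chain rule and the fundamental theorem of calculus for `-K ^ (-ε) / ε`, where `K` is a
primitive of a monotone function. -/
theorem integral_mul_rpow_primitive_of_monotone {k K : ℝ → ℝ} {a b c ε : ℝ} (hab : a ≤ b)
    (hε : 0 < ε) (hk : Monotone k) (hK : ∀ x, K x = (∫ s in a..x, k s) + c)
    (hpos : ∀ x ≥ a, 0 < K x) :
    IntervalIntegrable (fun x => k x * K x ^ (-(1 + ε))) volume a b ∧
      ∫ x in a..b, k x * K x ^ (-(1 + ε)) = (K a ^ (-ε) - K b ^ (-ε)) / ε := by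
  have hint (x y : ℝ) : IntervalIntegrable k volume x y := hk.intervalIntegrable
  have hcont : Continuous K := by
    rw [funext hK]
    exact (intervalIntegral.continuous_primitive hint a).add continuous_const
  have hpow (r : ℝ) : ContinuousOn (fun x => K x ^ r) (Icc a b) :=
    hcont.continuousOn.rpow_const fun x hx => Or.inl (hpos x hx.1).ne'
  have hφ : IntervalIntegrable (fun x => k x * K x ^ (-(1 + ε))) volume a b :=
    (hint a b).mul_continuousOn (by rw [uIcc_of_le hab]; exact hpow _)
  refine ⟨hφ, ?_⟩
  rw [integral_eq_of_hasDerivAt_off_countable_of_le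
    (fun x => -(K x ^ (-ε) / ε)) _ hab hk.countable_not_continuousAt
    ((hpow _).div_const ε).neg ?_ hφ]
  · ring
  · rintro x ⟨hx, hxc⟩
    have hxc : ContinuousAt k x := by simpa using hxc
    have hKx : HasDerivAt K (k x) x := by
      rw [funext hK]
      exact (intervalIntegral.integral_hasDerivAt_right (hint a x)
        hk.measurable.stronglyMeasurable.stronglyMeasurableAtFilter hxc).add_const c
    refine ((hKx.rpow_const (p := -ε)
      (Or.inl (hpos x hx.1.le).ne')).div_const ε).neg.congr_deriv ?_
    rw [show -ε - 1 = -(1 + ε) by ring]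
    field_simp

/-- If `H` is the integral of a nondecreasing positive function `h`, then
`h(x) ≤ H(x)^{1+ε}` outside a set of finite measure. -/
theorem stmt17 (x₀ ε : ℝ) (hx₀ : 0 < x₀) (hε : 0 < ε)
    (h H : ℝ → ℝ)
    (hpos : ∀ x ≥ x₀, 0 < h x)
    (Hpos : ∀ x ≥ x₀, 0 < H x)
    (hmono : ∀ x y, x₀ ≤ x → x ≤ y → h x ≤ h y)
    (hH : ∀ x ≥ x₀, H x = (∫ s in x₀..x, h s) + H x₀) :
    ∃ E : Set ℝ, E ⊆ Set.Ici x₀ ∧ MeasurableSet E ∧ MeasureTheory.volume E < ⊤ ∧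
      ∀ x ∈ Set.Ici x₀ \ E, h x ≤ H x ^ (1 + ε) := by
  set k : ℝ → ℝ := fun x => h (max x x₀) with hk_def
  set K : ℝ → ℝ := fun x => (∫ s in x₀..x, k s) + H x₀
  have hk : Monotone k := fun x y hxy => hmono _ _ (le_max_right _ _) (max_le_max_right _ hxy)
  have hkh (x : ℝ) (hx : x₀ ≤ x) : k x = h x := by simp [hk_def, hx]
  have hKH (x : ℝ) (hx : x₀ ≤ x) : K x = H x := by
    rw [hH x hx]
    refine congrArg (· + H x₀) ?_
    refine intervalIntegral.integral_congr fun s hs => hkh s ?_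
    rw [uIcc_of_le hx] at hs
    exact hs.1
  have hKpos (x : ℝ) (hx : x ≥ x₀) : 0 < K x := hKH x hx ▸ Hpos x hx
  have hKm : Measurable K :=
    ((intervalIntegral.continuous_primitive (fun _ _ => hk.intervalIntegrable) x₀).add
      continuous_const).measurable
  set E : Set ℝ := Ici x₀ ∩ {x | K x ^ (1 + ε) < k x}
  have hE : MeasurableSet E :=
    measurableSet_Ici.inter (measurableSet_lt (hKm.pow_const _) hk.measurable)
  refine ⟨E, inter_subset_left, hE, ?_, fun x hx => ?_⟩
  · have hbound (n : ℕ) : volume (E ∩ Iic (x₀ + n)) ≤ ENNReal.ofReal (K x₀ ^ (-ε) / ε) := by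
      have hn : x₀ ≤ x₀ + n := by simp
      obtain ⟨hφ, hval⟩ := integral_mul_rpow_primitive_of_monotone hn hε hk (fun _ => rfl) hKpos
      rw [intervalIntegrable_iff_integrableOn_Icc_of_le hn] at hφ
      rw [intervalIntegral.integral_of_le hn, ← integral_Icc_eq_integral_Ioc] at hval
      have hsub : E ∩ Iic (x₀ + n) ⊆ Icc x₀ (x₀ + n) := fun x hx => ⟨hx.1.1, hx.2⟩
      have hfin : volume (E ∩ Iic (x₀ + n)) ≠ ⊤ := measure_ne_top_of_subset hsub (by simp)
      have hm : MeasurableSet (E ∩ Iic (x₀ + n)) := hE.inter measurableSet_Iic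
      rw [← ENNReal.ofReal_toReal hfin]
      refine ENNReal.ofReal_le_ofReal ?_
      calc (volume (E ∩ Iic (x₀ + n))).toReal
          = ∫ x in E ∩ Iic (x₀ + n), (1 : ℝ) := by simp [Measure.real]
        _ ≤ ∫ x in E ∩ Iic (x₀ + n), k x * K x ^ (-(1 + ε)) := by
            refine setIntegral_mono_on (integrableOn_const hfin) (hφ.mono_set hsub) hm
              fun x hx => ?_
            have hKx := hKpos x hx.1.1
            rw [Real.rpow_neg hKx.le, ← div_eq_mul_inv, one_le_div (Real.rpow_pos_of_pos hKx _)]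
            exact hx.1.2.le
        _ ≤ ∫ x in Icc x₀ (x₀ + n), k x * K x ^ (-(1 + ε)) := by
            refine setIntegral_mono_set hφ ?_ hsub.eventuallyLE
            filter_upwards [ae_restrict_mem measurableSet_Icc] with x hx
            exact mul_nonneg (hkh x hx.1 ▸ (hpos x hx.1).le)
              (Real.rpow_nonneg (hKpos x hx.1).le _)
        _ ≤ K x₀ ^ (-ε) / ε := by
            rw [hval]
            gcongr
            exact sub_le_self _ (Real.rpow_nonneg (hKpos _ hn).le _)
    have hunion : E = ⋃ n : ℕ, E ∩ Iic (x₀ + n) := by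
      refine (inter_iUnion E _ ▸ inter_eq_left.2 fun x _ => ?_ : _ = E).symm
      obtain ⟨n, hn⟩ := exists_nat_ge (x - x₀)
      exact mem_iUnion.2 ⟨n, by simpa [add_comm] using hn⟩
    have hmonoE : Monotone fun n : ℕ => E ∩ Iic (x₀ + n) := fun m n hmn =>
      inter_subset_inter_right _ (Iic_subset_Iic.2 (by gcongr))
    rw [hunion, hmonoE.measure_iUnion]
    exact (iSup_le hbound).trans_lt ENNReal.ofReal_lt_top
  · have hx₁ : x₀ ≤ x := hx.1
    rw [← hkh x hx₁, ← hKH x hx₁]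
    exact not_lt.1 fun hlt => hx.2 ⟨hx₁, hlt⟩
end

section
/- Let x₀ > 0 and ε > 0, and let Φ : [x₀,∞) → (0,∞) be nondecreasing and convex. Denote by Φ'(x) the right derivative of Φ at x (which exists at every point by convexity). Then there exists a measurable set E ⊆ [x₀,∞) of finite Lebesgue measure such that Φ'(x) ≤ Φ(x)^{1+ε} for all x ∈ [x₀,∞)\E. (Applied to Φ(x) = B(eˣ) for the maximum function B of a direct tract, this gives a(r) ≤ B(r)^{1+ε} for all r ∈ [1,∞) outside a set of finite logarithmic measure.) -/
open Set Metric MeasureTheory Filter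

/-- A monotone function bounded below by a positive constant satisfies `f' ≤ f ^ (1 + ε)` at its
points of differentiability, outside a set of finite measure. -/
theorem volume_rpow_lt_deriv_lt_top {f : ℝ → ℝ} {c ε : ℝ} (hf : Monotone f) (hc : 0 < c)
    (hcf : ∀ x, c ≤ f x) (hε : 0 < ε) :
    MeasurableSet {x | DifferentiableAt ℝ f x ∧ f x ^ (1 + ε) < deriv f x} ∧
      volume {x | DifferentiableAt ℝ f x ∧ f x ^ (1 + ε) < deriv f x} < ⊤ := by
  set S : Set ℝ := {x | DifferentiableAt ℝ f x ∧ f x ^ (1 + ε) < deriv f x} with hS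
  have hfpos : ∀ x, 0 < f x := fun x ↦ hc.trans_le (hcf x)
  have hmeas : MeasurableSet S :=
    (measurableSet_of_differentiableAt ℝ f).inter
      (measurableSet_lt (hf.measurable.pow_const _) (measurable_deriv f))
  refine ⟨hmeas, ?_⟩
  let g : ℝ → ℝ := fun x ↦ -f x ^ (-ε)
  have hg_mono : Monotone g := fun x y hxy ↦
    neg_le_neg (Real.rpow_le_rpow_of_nonpos (hfpos x) (hf hxy) (by linarith))
  have hg_deriv : ∀ x ∈ S,
      HasDerivWithinAt g (-(deriv f x * (-ε) * f x ^ (-ε - 1))) S x := fun x hx ↦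
    (hx.1.hasDerivAt.rpow_const (Or.inl (hfpos x).ne')).neg.hasDerivWithinAt
  have hg_image : g '' S ⊆ Icc (-c ^ (-ε)) 0 := by
    rintro _ ⟨x, -, rfl⟩
    exact ⟨neg_le_neg (Real.rpow_le_rpow_of_nonpos hc (hcf x) (by linarith)),
      neg_nonpos.2 (Real.rpow_nonneg (hfpos x).le _)⟩
  have hg_le : ∀ x ∈ S, ε ≤ -(deriv f x * (-ε) * f x ^ (-ε - 1)) := by
    intro x hx
    have h1 : f x ^ (1 + ε) * f x ^ (-ε - 1) = 1 := by
      rw [← Real.rpow_add (hfpos x)]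
      ring_nf
      exact Real.rpow_zero _
    have h2 : 1 ≤ deriv f x * f x ^ (-ε - 1) :=
      h1.ge.trans <| mul_le_mul_of_nonneg_right hx.2.le (Real.rpow_nonneg (hfpos x).le _)
    nlinarith
  have hbound : ENNReal.ofReal ε * volume S < ⊤ := calc
    ENNReal.ofReal ε * volume S = ∫⁻ _ in S, ENNReal.ofReal ε := (setLIntegral_const _ _).symm
    _ ≤ ∫⁻ x in S, ENNReal.ofReal (-(deriv f x * (-ε) * f x ^ (-ε - 1))) :=
      setLIntegral_mono' hmeas fun x hx ↦ ENNReal.ofReal_le_ofReal (hg_le x hx)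
    _ = volume (g '' S) :=
      lintegral_deriv_eq_volume_image_of_monotoneOn hmeas hg_deriv (hg_mono.monotoneOn S)
    _ ≤ volume (Icc (-c ^ (-ε)) 0) := measure_mono hg_image
    _ < ⊤ := measure_Icc_lt_top
  exact ENNReal.lt_top_of_mul_ne_top_right hbound.ne (ENNReal.ofReal_pos.2 hε).ne'

/-- For a nondecreasing convex positive function `Φ`, the right derivative satisfies
`Φ'(x) ≤ Φ(x)^{1+ε}` outside a set of finite measure. -/
theorem stmt18 (x₀ ε : ℝ) (hx₀ : 0 < x₀) (hε : 0 < ε)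
    (Φ : ℝ → ℝ)
    (hpos : ∀ x ≥ x₀, 0 < Φ x)
    (hmono : MonotoneOn Φ (Set.Ici x₀))
    (hconv : ConvexOn ℝ (Set.Ici x₀) Φ) :
    ∃ E : Set ℝ, E ⊆ Set.Ici x₀ ∧ MeasurableSet E ∧ MeasureTheory.volume E < ⊤ ∧
      ∀ x ∈ Set.Ici x₀ \ E, derivWithin Φ (Set.Ici x) x ≤ Φ x ^ (1 + ε) := by
  let f : ℝ → ℝ := fun x ↦ Φ (max x₀ x)
  have hf : Monotone f := fun x y hxy ↦
    hmono (le_max_left x₀ x) (le_max_left x₀ y) (max_le_max le_rfl hxy)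
  have hfΦ : ∀ x ≥ x₀, f x = Φ x := fun x hx ↦ congrArg Φ (max_eq_right hx)
  obtain ⟨hmeas, hvol⟩ := volume_rpow_lt_deriv_lt_top hf (hpos x₀ le_rfl)
    (fun x ↦ hmono self_mem_Ici (le_max_left x₀ x) (le_max_left x₀ x)) hε
  have hnull : volume {x | ¬DifferentiableAt ℝ f x} = 0 := ae_iff.1 hf.ae_differentiableAt
  refine ⟨Ici x₀ ∩ ({x | DifferentiableAt ℝ f x ∧ f x ^ (1 + ε) < deriv f x} ∪
    {x | ¬DifferentiableAt ℝ f x}), inter_subset_left,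
    measurableSet_Ici.inter (hmeas.union (measurableSet_of_differentiableAt ℝ f).compl),
    (measure_mono inter_subset_right).trans_lt (measure_union_lt_top hvol (by simp [hnull])), ?_⟩
  rintro x ⟨hx, hxE⟩
  have hdiff : DifferentiableAt ℝ f x := by
    by_contra h
    exact hxE ⟨hx, Or.inr h⟩
  have hle : deriv f x ≤ f x ^ (1 + ε) := by
    by_contra! h
    exact hxE ⟨hx, Or.inl ⟨hdiff, h⟩⟩
  have hderiv : derivWithin Φ (Ici x) x = deriv f x := by
    rw [← hdiff.derivWithin (uniqueDiffWithinAt_Ici x)]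
    exact derivWithin_congr (fun y hy ↦ (hfΦ y (le_trans hx hy)).symm) (hfΦ x hx).symm
  rwa [hderiv, ← hfΦ x hx]
end
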